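/- arXiv:2312.02849 — 6 statements merged into one kernel-verified Lean document; each statement's English description precedes it below -/
import Mathlib

section
/- Let g₁, g₂ : [0,∞) → [0,∞) be continuous and strictly increasing, and suppose that for i = 1, 2 the map r ↦ gᵢ(r)·r is a bijection from [0,∞) onto [0,∞). Define Tᵢ : ℝ^d → ℝ^d by Tᵢ(x) = gᵢ(‖x‖)·x. Then T₂ is a bijection of ℝ^d and the composition T₁ ∘ T₂⁻¹ is the gradient of a convex function on ℝ^d. -/
open Filter Topology
open scoped NNReal

/-- A strictly increasing bijection of `[0, ∞)`, seen as an order isomorphism of `ℝ≥0`. -/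
theorem exists_orderIso_nnreal_of_bijOn {m : ℝ → ℝ} (hm : StrictMonoOn m (Set.Ici 0))
    (hbij : Set.BijOn m (Set.Ici 0) (Set.Ici 0)) :
    ∃ e : ℝ≥0 ≃o ℝ≥0, ∀ r : ℝ≥0, (e r : ℝ) = m r := by
  let f : ℝ≥0 → ℝ≥0 := fun r => ⟨m r, hbij.mapsTo r.2⟩
  have hf : StrictMono f := fun a b hab => hm a.2 b.2 hab
  have hsurj : Function.Surjective f := fun s => by
    obtain ⟨r, hr, hrs⟩ := hbij.surjOn s.2
    exact ⟨⟨r, hr⟩, Subtype.ext hrs⟩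
  exact ⟨hf.orderIsoOfSurjective f hsurj, fun r => rfl⟩

theorem coe_orderIso_nnreal_eq_zero_iff (e : ℝ≥0 ≃o ℝ≥0) (r : ℝ≥0) : (e r : ℝ) = 0 ↔ r = 0 := by
  have he : e 0 = 0 := map_bot e
  rw [NNReal.coe_eq_zero, ← e.injective.eq_iff (a := r), he]

theorem strictMonoOn_mul_id {g : ℝ → ℝ} (hg : StrictMonoOn g (Set.Ici 0))
    (hnn : ∀ r, 0 ≤ r → 0 ≤ g r) : StrictMonoOn (fun r => g r * r) (Set.Ici 0) := by
  intro a ha b hb hab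
  exact mul_lt_mul_of_nonneg (hg ha hb hab) hab (hnn a ha) ha

section Radial

variable {E : Type*} [NormedAddCommGroup E]

theorem bijective_radial [NormedSpace ℝ E] {g : ℝ → ℝ}
    (hnn : ∀ r, 0 ≤ r → 0 ≤ g r) (e : ℝ≥0 ≃o ℝ≥0) (he : ∀ r : ℝ≥0, (e r : ℝ) = g r * r) :
    Function.Bijective fun x : E => g ‖x‖ • x := by
  have hnorm (x : E) : ‖g ‖x‖ • x‖ = e ‖x‖₊ := by
    rw [norm_smul, Real.norm_of_nonneg (hnn _ (norm_nonneg x)), he, coe_nnnorm]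
  constructor
  · intro x y hxy
    have hn : ‖x‖₊ = ‖y‖₊ := e.injective <| NNReal.coe_injective <| by
      rw [← hnorm, ← hnorm]; exact congrArg norm hxy
    have hn' : ‖x‖ = ‖y‖ := congrArg NNReal.toReal hn
    by_cases hg : g ‖x‖ = 0
    · have h0 : ‖x‖₊ = 0 := by
        rw [← coe_orderIso_nnreal_eq_zero_iff e, he, coe_nnnorm, hg, zero_mul]
      rw [nnnorm_eq_zero.1 h0, nnnorm_eq_zero.1 (hn.symm.trans h0)]
    · exact smul_right_injective E hg (by simpa only [← hn'] using hxy)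
  · intro y
    obtain rfl | hy := eq_or_ne y 0
    · exact ⟨0, smul_zero _⟩
    have hy' : ‖y‖ ≠ 0 := norm_ne_zero_iff.2 hy
    set r := e.symm ‖y‖₊ with hr
    have hgr : g r * r = ‖y‖ := by rw [← he, hr, e.apply_symm_apply, coe_nnnorm]
    have hx : ‖((r : ℝ) / ‖y‖) • y‖ = r := by
      rw [norm_smul, Real.norm_of_nonneg (by positivity), div_mul_cancel₀ _ hy']
    refine ⟨((r : ℝ) / ‖y‖) • y, ?_⟩
    simp only [hx]
    rw [smul_smul, ← mul_div_assoc, hgr, div_self hy', one_smul]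

variable [InnerProductSpace ℝ E] [CompleteSpace E]

theorem hasGradientAt_comp_norm {H : ℝ → ℝ} {h' : ℝ} {y : E} (hH : HasDerivAt H h' ‖y‖)
    (h0 : y = 0 → h' = 0) :
    HasGradientAt (fun x : E => H ‖x‖) ((h' / ‖y‖) • y) y := by
  rw [hasGradientAt_iff_hasFDerivAt]
  obtain rfl | hy := eq_or_ne y 0
  · rw [h0 rfl, hasDerivAt_iff_isLittleO, norm_zero] at hH
    have ht : Tendsto (fun x : E => ‖x‖) (𝓝 0) (𝓝 0) := by
      simpa using (continuous_norm (E := E)).tendsto 0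
    refine .of_isLittleO ?_
    simpa [Function.comp_def] using (hH.comp_tendsto ht).trans_isBigO
      (by simpa [Function.comp_def] using
        (Asymptotics.isBigO_refl (fun x : E => x) (𝓝 0)).norm_left)
  · have hn : HasFDerivAt (fun x : E => ‖x‖) (‖y‖⁻¹ • innerSL ℝ y) y := by
      have hsq := (hasStrictFDerivAt_norm_sq y).hasFDerivAt.sqrt (by positivity)
      simp only [Real.sqrt_sq (norm_nonneg _)] at hsq
      refine hsq.congr_fderiv ?_
      ext v
      simp
      field_simp
    refine (hH.comp_hasFDerivAt y hn).congr_fderiv ?_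
    ext v
    simp [div_eq_mul_inv, mul_assoc]

/-- The radial map with a continuous increasing profile vanishing at `0` is the gradient of a
convex function. -/
theorem exists_convexOn_hasGradientAt_radial {h : ℝ → ℝ} (hc : Continuous h) (hm : Monotone h)
    (h0 : h 0 = 0) :
    ∃ φ : E → ℝ, ConvexOn ℝ Set.univ φ ∧ ∀ y, HasGradientAt φ ((h ‖y‖ / ‖y‖) • y) y := by
  let H : ℝ → ℝ := fun t => ∫ s in (0 : ℝ)..t, h s
  have hH (t : ℝ) : HasDerivAt H (h t) t := hc.integral_hasStrictDerivAt 0 t |>.hasDerivAt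
  have hderiv : deriv H = h := funext fun t => (hH t).deriv
  have hconv : ConvexOn ℝ Set.univ H :=
    Monotone.convexOn_univ_of_deriv (fun t => (hH t).differentiableAt) (hderiv ▸ hm)
  have hmono : MonotoneOn H (Set.Ici 0) := by
    refine monotoneOn_of_deriv_nonneg (convex_Ici 0)
      (fun t _ => (hH t).continuousAt.continuousWithinAt)
      (fun t _ => (hH t).differentiableAt.differentiableWithinAt) fun t ht => ?_
    rw [hderiv, ← h0]
    exact hm (interior_subset ht)
  refine ⟨fun x => H ‖x‖, ⟨convex_univ, fun x _ y _ a b ha hb hab => ?_⟩, fun y =>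
    hasGradientAt_comp_norm (hH ‖y‖) fun hy => by rw [hy, norm_zero, h0]⟩
  exact (hmono (norm_nonneg _) (Set.mem_Ici.2 (by positivity))
    (convexOn_univ_norm.2 trivial trivial ha hb hab)).trans
    (hconv.2 trivial trivial ha hb hab)

end Radial


theorem stmt_1 {d : ℕ} (g₁ g₂ : ℝ → ℝ)
    (hc₁ : ContinuousOn g₁ (Set.Ici 0)) (hc₂ : ContinuousOn g₂ (Set.Ici 0))
    (hm₁ : StrictMonoOn g₁ (Set.Ici 0)) (hm₂ : StrictMonoOn g₂ (Set.Ici 0))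
    (hnn₁ : ∀ r, 0 ≤ r → 0 ≤ g₁ r) (hnn₂ : ∀ r, 0 ≤ r → 0 ≤ g₂ r)
    (hbij₁ : Set.BijOn (fun r => g₁ r * r) (Set.Ici 0) (Set.Ici 0))
    (hbij₂ : Set.BijOn (fun r => g₂ r * r) (Set.Ici 0) (Set.Ici 0))
    (T₁ T₂ : EuclideanSpace ℝ (Fin d) → EuclideanSpace ℝ (Fin d))
    (hT₁ : ∀ x, T₁ x = g₁ ‖x‖ • x) (hT₂ : ∀ x, T₂ x = g₂ ‖x‖ • x) :
    Function.Bijective T₂ ∧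
    ∃ φ : EuclideanSpace ℝ (Fin d) → ℝ,
      ConvexOn ℝ Set.univ φ ∧ Differentiable ℝ φ ∧
      ∀ y, gradient φ y = T₁ (Function.invFun T₂ y) := by
  obtain ⟨e₁, he₁⟩ := exists_orderIso_nnreal_of_bijOn (strictMonoOn_mul_id hm₁ hnn₁) hbij₁
  obtain ⟨e₂, he₂⟩ := exists_orderIso_nnreal_of_bijOn (strictMonoOn_mul_id hm₂ hnn₂) hbij₂
  have hT₂bij : Function.Bijective T₂ := by
    rw [funext hT₂]
    exact bijective_radial hnn₂ e₂ he₂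
  let e : ℝ≥0 ≃o ℝ≥0 := e₂.symm.trans e₁
  obtain ⟨φ, hφ, hgrad⟩ := exists_convexOn_hasGradientAt_radial
    (E := EuclideanSpace ℝ (Fin d)) (h := fun s => (e s.toNNReal : ℝ))
    (NNReal.continuous_coe.comp (e.continuous.comp continuous_real_toNNReal))
    (fun a b hab => NNReal.coe_le_coe.2 (e.monotone (Real.toNNReal_mono hab)))
    (by simpa using map_bot e)
  refine ⟨hT₂bij, φ, hφ, fun y => (hgrad y).differentiableAt, fun y => ?_⟩
  obtain ⟨x, rfl⟩ := hT₂bij.surjective y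
  rw [Function.leftInverse_invFun hT₂bij.injective, (hgrad _).gradient, hT₁]
  obtain rfl | hx := eq_or_ne x 0
  · simp [hT₂]
  have hnorm : ‖T₂ x‖ = e₂ ‖x‖₊ := by
    rw [hT₂, norm_smul, Real.norm_of_nonneg (hnn₂ _ (norm_nonneg x)), he₂, coe_nnnorm]
  have hpos : (e₂ ‖x‖₊ : ℝ) ≠ 0 := by
    rwa [Ne, coe_orderIso_nnreal_eq_zero_iff, nnnorm_eq_zero]
  have hcomp : e (e₂ ‖x‖₊) = e₁ ‖x‖₊ := congrArg e₁ (e₂.symm_apply_apply _)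
  rw [hnorm, Real.toNNReal_coe, hcomp, hT₂, smul_smul]
  congr 1
  rw [he₂, coe_nnnorm] at hpos
  rw [he₁, he₂, coe_nnnorm, mul_div_mul_right _ _ (right_ne_zero_of_mul hpos),
    div_mul_cancel₀ _ (left_ne_zero_of_mul hpos)]
end

section
/- Let M = {T₁, …, T_J} be a finite family of bijections of ℝ^d such that each Tⱼ is the gradient of a convex function and, for all i, j, the composition Tᵢ ∘ Tⱼ⁻¹ is the gradient of a convex function. Let η, λ ∈ [0,∞)^J with η ≠ 0 and λ ≠ 0, suppose S := Σⱼ ηⱼ Tⱼ is a bijection of ℝ^d, and suppose that for each j, Tⱼ ∘ S⁻¹ is a bijection of ℝ^d. Then the map (Σⱼ λⱼ Tⱼ) ∘ S⁻¹ is the gradient of a convex function on ℝ^d. -/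
open Filter Topology Set

open scoped RealInnerProductSpace

section ConvexGradient

variable {E : Type*} [NormedAddCommGroup E] [InnerProductSpace ℝ E]

/-- A selection of subgradients of a locally Lipschitz function is locally bounded. -/
theorem LocallyLipschitz.exists_eventually_norm_le_of_add_inner_le {φ : E → ℝ} {G : E → E}
    (hφ : LocallyLipschitz φ) (hG : ∀ y z, φ y + ⟪G y, z - y⟫ ≤ φ z) (y : E) :
    ∃ K : ℝ, ∀ᶠ z in 𝓝 y, ‖G z‖ ≤ K := by
  obtain ⟨K, t, ht, hK⟩ := hφ y
  refine ⟨K, ?_⟩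
  filter_upwards [eventually_mem_nhds_iff.2 ht] with z hz
  have hpath : Tendsto (fun s : ℝ => z + s • G z) (𝓝[>] 0) (𝓝 z) := by
    have : Continuous (fun s : ℝ => z + s • G z) := by fun_prop
    simpa using (this.tendsto 0).mono_left nhdsWithin_le_nhds
  obtain ⟨s, hst, hs⟩ := ((hpath.eventually hz).and self_mem_nhdsWithin).exists
  have hs : 0 < s := hs
  have h₁ := hG z (z + s • G z)
  have h₂ := hK.dist_le_mul _ hst z (mem_of_mem_nhds hz)
  rw [add_sub_cancel_left, real_inner_smul_right, real_inner_self_eq_norm_sq] at h₁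
  rw [Real.dist_eq, dist_eq_norm, add_sub_cancel_left, norm_smul, Real.norm_of_nonneg hs.le] at h₂
  have h₃ := (le_abs_self _).trans h₂
  by_contra! hlt
  have hpos : 0 < ‖G z‖ := K.coe_nonneg.trans_lt hlt
  have := mul_lt_mul_of_pos_right hlt (mul_pos hs hpos)
  nlinarith

variable [CompleteSpace E]

/-- `F` is the gradient of a convex differentiable function on the whole space. -/
def IsConvexGradient (F : E → E) : Prop :=
  ∃ φ : E → ℝ, ConvexOn ℝ univ φ ∧ ∀ x, HasGradientAt φ (F x) x

theorem isConvexGradient_iff {F : E → E} :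
    IsConvexGradient F ↔
      ∃ φ : E → ℝ, ConvexOn ℝ univ φ ∧ Differentiable ℝ φ ∧ ∀ x, gradient φ x = F x := by
  constructor
  · rintro ⟨φ, hc, h⟩
    exact ⟨φ, hc, fun x => (h x).differentiableAt, fun x => (h x).gradient⟩
  · rintro ⟨φ, hc, hd, h⟩
    exact ⟨φ, hc, fun x => h x ▸ (hd x).hasGradientAt⟩

theorem isConvexGradient_zero : IsConvexGradient (fun _ : E => (0 : E)) :=
  ⟨fun _ => 0, convexOn_const 0 convex_univ, fun x => hasGradientAt_const x 0⟩

theorem IsConvexGradient.add {F G : E → E} (hF : IsConvexGradient F) (hG : IsConvexGradient G) :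
    IsConvexGradient (fun x => F x + G x) := by
  obtain ⟨φ, hφ, hφ'⟩ := hF
  obtain ⟨ψ, hψ, hψ'⟩ := hG
  refine ⟨φ + ψ, hφ.add hψ, fun x => ?_⟩
  rw [hasGradientAt_iff_hasFDerivAt, map_add]
  exact (hφ' x).hasFDerivAt.add (hψ' x).hasFDerivAt

theorem IsConvexGradient.const_smul {F : E → E} (hF : IsConvexGradient F) {c : ℝ} (hc : 0 ≤ c) :
    IsConvexGradient (fun x => c • F x) := by
  obtain ⟨φ, hφ, hφ'⟩ := hF
  refine ⟨fun x => c • φ x, hφ.smul hc, fun x => ?_⟩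
  rw [hasGradientAt_iff_hasFDerivAt, map_smul]
  exact (hφ' x).hasFDerivAt.const_smul c

theorem IsConvexGradient.sum {ι : Type*} (s : Finset ι) {F : ι → E → E}
    (hF : ∀ i ∈ s, IsConvexGradient (F i)) : IsConvexGradient (fun x => ∑ i ∈ s, F i x) := by
  classical
  induction s using Finset.induction_on with
  | empty => simpa using isConvexGradient_zero
  | insert a s ha ih =>
    simp only [Finset.sum_insert ha]
    exact (hF a (Finset.mem_insert_self a s)).add
      (ih fun i hi => hF i (Finset.mem_insert_of_mem hi))

theorem ConvexOn.add_inner_le_of_hasGradientAt {φ : E → ℝ} {g x : E} (hφ : ConvexOn ℝ univ φ)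
    (hg : HasGradientAt φ g x) (y : E) : φ x + ⟪g, y - x⟫ ≤ φ y := by
  have hline : ConvexOn ℝ univ (φ ∘ AffineMap.lineMap (k := ℝ) x y) := by
    simpa using hφ.comp_affineMap (AffineMap.lineMap (k := ℝ) x y)
  have hg' : HasFDerivAt φ (InnerProductSpace.toDual ℝ E g)
      (AffineMap.lineMap (k := ℝ) x y 0) := by
    simpa using hg.hasFDerivAt
  have hderiv := hg'.comp_hasDerivAt (0 : ℝ) AffineMap.hasDerivAt_lineMap
  have h := hline.le_slope_of_hasDerivAt (mem_univ 0) (mem_univ 1) one_pos hderiv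
  simp [slope_def_field] at h
  linarith

theorem HasGradientAt.eq_of_add_inner_le {φ : E → ℝ} {g p x : E} (hg : HasGradientAt φ g x)
    (hp : ∀ y, φ x + ⟪p, y - x⟫ ≤ φ y) : g = p := by
  have hmin : IsLocalMin (fun y => φ y - InnerProductSpace.toDual ℝ E p y) x :=
    Eventually.of_forall fun y => by
      have := hp y
      simp only [inner_sub_right] at this
      simp only [InnerProductSpace.toDual_apply_apply]
      linarith
  have h := hmin.hasFDerivAt_eq_zero
    (hg.hasFDerivAt.sub (InnerProductSpace.toDual ℝ E p).hasFDerivAt)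
  exact (InnerProductSpace.toDual ℝ E).injective (sub_eq_zero.1 h)

/-- A function admitting a continuous selection of subgradients is differentiable. -/
theorem hasGradientAt_of_add_inner_le {φ : E → ℝ} {G : E → E} {y : E}
    (hG : ∀ y z, φ y + ⟪G y, z - y⟫ ≤ φ z) (hcont : ContinuousAt G y) :
    HasGradientAt φ (G y) y := by
  rw [hasGradientAt_iff_isLittleO, Asymptotics.isLittleO_iff]
  intro c hc
  filter_upwards [Metric.continuousAt_iff'.1 hcont c hc] with z hz
  have h₁ := hG y z
  have h₂ := hG z y
  have h₃ : ⟪G z - G y, z - y⟫ ≤ c * ‖z - y‖ := by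
    refine (real_inner_le_norm _ _).trans ?_
    rw [dist_eq_norm] at hz
    gcongr
  rw [← neg_sub z y, inner_neg_right] at h₂
  rw [inner_sub_left] at h₃
  rw [Real.norm_of_nonneg (by linarith)]
  linarith

/-- The inverse of a bijective gradient of a convex function is the gradient of the
convex conjugate. -/
theorem IsConvexGradient.of_inverse [FiniteDimensional ℝ E] {H G : E → E}
    (hH : IsConvexGradient H) (hleft : Function.LeftInverse G H)
    (hright : Function.RightInverse G H) : IsConvexGradient G := by
  obtain ⟨ψ, hψ, hgrad⟩ := hH
  have hsub : ∀ x w, ψ x + ⟪H x, w - x⟫ ≤ ψ w := fun x =>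
    hψ.add_inner_le_of_hasGradientAt (hgrad x)
  have hψcont : Continuous ψ := continuous_iff_continuousAt.2 fun x => (hgrad x).continuousAt
  set φ : E → ℝ := fun y => ⟪y, G y⟫ - ψ (G y) with hφdef
  have hφsub : ∀ y z, φ y + ⟪G y, z - y⟫ ≤ φ z := by
    intro y z
    have h := hsub (G z) (G y)
    rw [hright z, inner_sub_right] at h
    simp only [hφdef, real_inner_comm (z - y) (G y), inner_sub_left]
    linarith
  have hφ : ConvexOn ℝ univ φ := by
    refine ⟨convex_univ, fun y _ z _ a b ha hb hab => ?_⟩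
    set m := a • y + b • z with hm
    have hzero : a * ⟪G m, y - m⟫ + b * ⟪G m, z - m⟫ = 0 := by
      simp only [inner_sub_right, hm, inner_add_right, real_inner_smul_right]
      linear_combination (-(a * ⟪G (a • y + b • z), y⟫ + b * ⟪G (a • y + b • z), z⟫)) * hab
    have h₁ := mul_le_mul_of_nonneg_left (hφsub m y) ha
    have h₂ := mul_le_mul_of_nonneg_left (hφsub m z) hb
    have h₃ : φ m = a * φ m + b * φ m := by rw [← add_mul, hab, one_mul]
    simp only [smul_eq_mul]
    linarith
  have hGcont : ∀ y, ContinuousAt G y := by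
    intro y
    obtain ⟨K, hK⟩ :=
      hφ.locallyLipschitz.exists_eventually_norm_le_of_add_inner_le hφsub y
    refine (tendsto_iff_ultrafilter _ _ _).2 fun f hf => ?_
    obtain ⟨x, -, hx⟩ := (isCompact_closedBall (0 : E) K).ultrafilter_le_nhds' (f.map G) (by
      have hfK : ∀ᶠ z in (f : Filter E), ‖G z‖ ≤ K := hf hK
      exact hfK.mono fun z hz => mem_closedBall_zero_iff.2 hz)
    have hx : Tendsto G f (𝓝 x) := hx
    have hid : Tendsto (fun z : E => z) f (𝓝 y) := hf
    have hHx : H x = y := (hgrad x).eq_of_add_inner_le fun w => by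
      refine le_of_tendsto (((hψcont.tendsto x).comp hx).add
        (hid.inner (tendsto_const_nhds.sub hx))) (Eventually.of_forall fun z => ?_)
      simpa only [hright z, Function.comp_apply] using hsub (G z) w
    rwa [← hHx, hleft x]
  exact ⟨φ, hφ, fun y => hasGradientAt_of_add_inner_le hφsub (hGcont y)⟩

end ConvexGradient


theorem stmt_4 {d J : ℕ}
    (T : Fin J → (EuclideanSpace ℝ (Fin d) → EuclideanSpace ℝ (Fin d)))
    (hbij : ∀ j, Function.Bijective (T j))
    (hgrad : ∀ j, ∃ φ : EuclideanSpace ℝ (Fin d) → ℝ,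
      ConvexOn ℝ Set.univ φ ∧ Differentiable ℝ φ ∧ ∀ x, gradient φ x = T j x)
    (hcompat : ∀ i j, ∃ φ : EuclideanSpace ℝ (Fin d) → ℝ,
      ConvexOn ℝ Set.univ φ ∧ Differentiable ℝ φ ∧
      ∀ y, gradient φ y = T i (Function.invFun (T j) y))
    (η lam : Fin J → ℝ)
    (hη : ∀ j, 0 ≤ η j) (hlam : ∀ j, 0 ≤ lam j)
    (hη0 : η ≠ 0) (hlam0 : lam ≠ 0)
    (S : EuclideanSpace ℝ (Fin d) → EuclideanSpace ℝ (Fin d))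
    (hS : ∀ x, S x = ∑ j, η j • T j x)
    (hSbij : Function.Bijective S)
    (hTS : ∀ j, Function.Bijective (fun y => T j (Function.invFun S y))) :
    ∃ φ : EuclideanSpace ℝ (Fin d) → ℝ,
      ConvexOn ℝ Set.univ φ ∧ Differentiable ℝ φ ∧
      ∀ y, gradient φ y = ∑ j, lam j • T j (Function.invFun S y) := by
  simp only [← isConvexGradient_iff] at hcompat ⊢
  refine IsConvexGradient.sum _ fun i _ => IsConvexGradient.const_smul ?_ (hlam i)
  have hST : IsConvexGradient fun y => S (Function.invFun (T i) y) := by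
    simp only [hS]
    exact IsConvexGradient.sum _ fun j _ => (hcompat j i).const_smul (hη j)
  refine hST.of_inverse (fun x => ?_) (fun y => ?_)
  · simp only [Function.leftInverse_invFun hSbij.injective _,
      Function.rightInverse_invFun (hbij i).surjective _]
  · simp only [Function.leftInverse_invFun (hbij i).injective _,
      Function.rightInverse_invFun hSbij.surjective _]
end

section
/- Let 0 < ℓ ≤ L and set κ = L/ℓ. Let W : ℝ → ℝ be twice differentiable with ℓ ≤ W''(y) ≤ L for all y ∈ ℝ. Let T : ℝ → ℝ be twice differentiable with 1/√L ≤ T'(x) ≤ 1/√ℓ for all x, and suppose there is a constant c ∈ ℝ such that the one-dimensional Monge–Ampère identity W(T(x)) = x²/2 + log T'(x) + c holds for all x ∈ ℝ. Suppose further that there exists x̃ ∈ ℝ with W'(x̃) = 0 and |T(0) − x̃| ≤ 3/√ℓ. Then for all x ∈ ℝ, T''(x) = −T'(x)·(x − W'(T(x))·T'(x)), and |T''(x)| ≤ (3κ/√ℓ)·(1 + |x|). -/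
theorem abs_sub_le_of_abs_deriv_le {f : ℝ → ℝ} {C : ℝ} (hf : Differentiable ℝ f)
    (hC : ∀ x, |deriv f x| ≤ C) (x y : ℝ) : |f x - f y| ≤ C * |x - y| :=
  convex_univ.norm_image_sub_le_of_norm_deriv_le (fun z _ => hf z) (fun z _ => hC z)
    (Set.mem_univ y) (Set.mem_univ x)

/-- Differentiating the one-dimensional Monge–Ampère identity for the Gaussian source. -/
theorem deriv_deriv_of_monge_ampere {W T : ℝ → ℝ} {c : ℝ} (hW : Differentiable ℝ W)
    (hT : Differentiable ℝ T) (hT' : Differentiable ℝ (deriv T)) (hpos : ∀ x, 0 < deriv T x)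
    (hMA : ∀ x, W (T x) = x ^ 2 / 2 + Real.log (deriv T x) + c) (x : ℝ) :
    deriv (deriv T) x = -(deriv T x) * (x - deriv W (T x) * deriv T x) := by
  have hleft : HasDerivAt (fun y => W (T y)) (deriv W (T x) * deriv T x) x :=
    (hW (T x)).hasDerivAt.comp x (hT x).hasDerivAt
  have hright : HasDerivAt (fun y => y ^ 2 / 2 + Real.log (deriv T y) + c)
      (x + deriv (deriv T) x / deriv T x) x := by
    have hsq : HasDerivAt (fun y : ℝ => y ^ 2 / 2) x x := by
      simpa using (hasDerivAt_pow 2 x).div_const 2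
    exact (hsq.add ((hT' x).hasDerivAt.log (hpos x).ne')).add_const c
  rw [← funext hMA] at hright
  have hne := (hpos x).ne'
  rw [hleft.unique hright]
  field_simp
  ring

theorem stmt_14 (ℓ L : ℝ) (hℓ : 0 < ℓ) (hℓL : ℓ ≤ L) (κ : ℝ) (hκ : κ = L / ℓ)
    (W : ℝ → ℝ) (hW : Differentiable ℝ W) (hW' : Differentiable ℝ (deriv W))
    (hW'' : ∀ y, ℓ ≤ deriv (deriv W) y ∧ deriv (deriv W) y ≤ L)
    (T : ℝ → ℝ) (hT : Differentiable ℝ T) (hT' : Differentiable ℝ (deriv T))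
    (hT'bound : ∀ x, 1 / Real.sqrt L ≤ deriv T x ∧ deriv T x ≤ 1 / Real.sqrt ℓ)
    (c : ℝ) (hMA : ∀ x, W (T x) = x ^ 2 / 2 + Real.log (deriv T x) + c)
    (xt : ℝ) (hxt : deriv W xt = 0) (hclose : |T 0 - xt| ≤ 3 / Real.sqrt ℓ) :
    ∀ x, deriv (deriv T) x = -(deriv T x) * (x - deriv W (T x) * deriv T x) ∧
      |deriv (deriv T) x| ≤ (3 * κ / Real.sqrt ℓ) * (1 + |x|) := by
  have hL : 0 < L := hℓ.trans_le hℓL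
  have hpos : ∀ x, 0 < deriv T x := fun x =>
    (one_div_pos.2 (Real.sqrt_pos.2 hL)).trans_le (hT'bound x).1
  intro x
  have hT'' := deriv_deriv_of_monge_ampere hW hT hT' hpos hMA x
  refine ⟨hT'', ?_⟩
  set s := 1 / Real.sqrt ℓ with hs
  have hs0 : 0 < s := one_div_pos.2 (Real.sqrt_pos.2 hℓ)
  have hss : s * s = 1 / ℓ := by
    rw [hs, div_mul_div_comm, Real.mul_self_sqrt hℓ.le, one_mul]
  have hTx : |T x - T 0| ≤ s * |x| := by
    simpa using abs_sub_le_of_abs_deriv_le hT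
      (fun y => (abs_of_pos (hpos y)).le.trans (hT'bound y).2) x 0
  have hdist : |T x - xt| ≤ s * (3 + |x|) := by
    have h3 : 3 / Real.sqrt ℓ = 3 * s := by rw [hs]; ring
    have := abs_sub_le (T x) (T 0) xt
    linarith
  have hWT : |deriv W (T x)| ≤ L * (s * (3 + |x|)) := by
    have h := abs_sub_le_of_abs_deriv_le hW'
      (fun y => (abs_of_pos (hℓ.trans_le (hW'' y).1)).le.trans (hW'' y).2) (T x) xt
    rw [hxt, sub_zero] at h
    exact h.trans (by gcongr)
  have hκ1 : 1 ≤ κ := by rwa [hκ, one_le_div hℓ]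
  calc |deriv (deriv T) x|
      = deriv T x * |x - deriv W (T x) * deriv T x| := by
        rw [hT'', abs_mul, abs_neg, abs_of_pos (hpos x)]
    _ ≤ deriv T x * (|x| + |deriv W (T x)| * deriv T x) := by
        have h := abs_sub x (deriv W (T x) * deriv T x)
        rw [abs_mul, abs_of_pos (hpos x)] at h
        exact mul_le_mul_of_nonneg_left h (hpos x).le
    _ ≤ s * (|x| + L * (s * (3 + |x|)) * s) := by
        have h1 := (hT'bound x).2
        have h0 := (hpos x).le
        gcongr
    _ = s * (|x| + κ * (3 + |x|)) := by
        rw [hκ]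
        linear_combination s * L * (3 + |x|) * hss
    _ ≤ s * (3 * κ * (1 + |x|)) := by
        gcongr
        nlinarith [mul_nonneg (sub_nonneg.2 hκ1) (abs_nonneg x), abs_nonneg x]
    _ = 3 * κ / Real.sqrt ℓ * (1 + |x|) := by rw [hs]; ring
end

section
/- Let 0 < ℓ ≤ L and set κ = L/ℓ. Let W : ℝ → ℝ be twice differentiable with ℓ ≤ W''(y) ≤ L for all y ∈ ℝ. Let T : ℝ → ℝ be three times differentiable with 1/√L ≤ T'(x) ≤ 1/√ℓ for all x, and suppose there is a constant c ∈ ℝ such that W(T(x)) = x²/2 + log T'(x) + c for all x ∈ ℝ. Suppose further that there exists x̃ ∈ ℝ with W'(x̃) = 0 and |T(0) − x̃| ≤ 3/√ℓ. Then for all x ∈ ℝ, T'''(x) = T''(x)²/T'(x) − T'(x)·(1 − W''(T(x))·T'(x)² − W'(T(x))·T''(x)), and |T'''(x)| ≤ (40κ²/√ℓ)·(1 + x²). -/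
/-- Mean value inequality on the whole line. -/
theorem abs_sub_le_mul_abs_sub_of_abs_deriv_le {f : ℝ → ℝ} {C : ℝ} (hf : Differentiable ℝ f)
    (hC : ∀ x, |deriv f x| ≤ C) (x y : ℝ) : |f y - f x| ≤ C * |y - x| :=
  Convex.norm_image_sub_le_of_norm_deriv_le (s := Set.univ) (fun z _ => hf z)
    (fun z _ => hC z) convex_univ (Set.mem_univ x) (Set.mem_univ y)

/-- First derivative of the Monge–Ampère identity `W ∘ T = x ^ 2 / 2 + log T' + c`. -/
theorem deriv_deriv_eq_of_mongeAmpere {W T : ℝ → ℝ} {c : ℝ} (hW : Differentiable ℝ W)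
    (hT : Differentiable ℝ T) (hT' : Differentiable ℝ (deriv T)) (hpos : ∀ x, 0 < deriv T x)
    (hMA : ∀ x, W (T x) = x ^ 2 / 2 + Real.log (deriv T x) + c) (x : ℝ) :
    deriv (deriv T) x = deriv T x * (deriv W (T x) * deriv T x - x) := by
  have h₁ : HasDerivAt (fun y => W (T y)) (deriv W (T x) * deriv T x) x :=
    (hW (T x)).hasDerivAt.comp x (hT x).hasDerivAt
  have h₂ : HasDerivAt (fun y => W (T y)) (x + deriv (deriv T) x / deriv T x) x := by
    rw [funext hMA]
    refine ((((hasDerivAt_pow 2 x).div_const 2).add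
      ((hT' x).hasDerivAt.log (hpos x).ne')).add_const c).congr_deriv ?_
    norm_num
  have hx := (hpos x).ne'
  rw [h₁.unique h₂]
  field_simp
  ring

/-- Second derivative of the Monge–Ampère identity `W ∘ T = x ^ 2 / 2 + log T' + c`. -/
theorem deriv_deriv_deriv_eq_of_mongeAmpere {W T : ℝ → ℝ} {c : ℝ} (hW : Differentiable ℝ W)
    (hW' : Differentiable ℝ (deriv W)) (hT : Differentiable ℝ T)
    (hT' : Differentiable ℝ (deriv T)) (hpos : ∀ x, 0 < deriv T x)
    (hMA : ∀ x, W (T x) = x ^ 2 / 2 + Real.log (deriv T x) + c) (x : ℝ) :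
    deriv (deriv (deriv T)) x =
      (deriv (deriv T) x) ^ 2 / deriv T x -
        deriv T x * (1 - deriv (deriv W) (T x) * (deriv T x) ^ 2
          - deriv W (T x) * deriv (deriv T) x) := by
  have h₂ := deriv_deriv_eq_of_mongeAmpere hW hT hT' hpos hMA
  have hg : HasDerivAt (fun y => deriv W (T y)) (deriv (deriv W) (T x) * deriv T x) x :=
    (hW' (T x)).hasDerivAt.comp x (hT x).hasDerivAt
  have h₃ := (hT' x).hasDerivAt.mul ((hg.mul (hT' x).hasDerivAt).sub (hasDerivAt_id x))
  have hx := (hpos x).ne'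
  have h₄ : deriv (deriv T) = deriv T * ((fun y => deriv W (T y)) * deriv T - id) := funext h₂
  rw [← h₄] at h₃
  rw [h₃.deriv, h₄]
  simp only [Pi.mul_apply, Pi.sub_apply, id_eq]
  field_simp
  ring

theorem stmt_15 (ℓ L : ℝ) (hℓ : 0 < ℓ) (hℓL : ℓ ≤ L) (κ : ℝ) (hκ : κ = L / ℓ)
    (W : ℝ → ℝ) (hW : Differentiable ℝ W) (hW' : Differentiable ℝ (deriv W))
    (hW'' : ∀ y, ℓ ≤ deriv (deriv W) y ∧ deriv (deriv W) y ≤ L)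
    (T : ℝ → ℝ) (hT : Differentiable ℝ T) (hT' : Differentiable ℝ (deriv T))
    (hT'' : Differentiable ℝ (deriv (deriv T)))
    (hT'bound : ∀ x, 1 / Real.sqrt L ≤ deriv T x ∧ deriv T x ≤ 1 / Real.sqrt ℓ)
    (c : ℝ) (hMA : ∀ x, W (T x) = x ^ 2 / 2 + Real.log (deriv T x) + c)
    (xt : ℝ) (hxt : deriv W xt = 0) (hclose : |T 0 - xt| ≤ 3 / Real.sqrt ℓ) :
    ∀ x, deriv (deriv (deriv T)) x =
        (deriv (deriv T) x) ^ 2 / deriv T x -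
          deriv T x * (1 - deriv (deriv W) (T x) * (deriv T x) ^ 2
            - deriv W (T x) * deriv (deriv T) x) ∧
      |deriv (deriv (deriv T)) x| ≤ (40 * κ ^ 2 / Real.sqrt ℓ) * (1 + x ^ 2) := by
  have hs : 0 < √ℓ := Real.sqrt_pos.2 hℓ
  have hss : √ℓ * √ℓ = ℓ := Real.mul_self_sqrt hℓ.le
  have hL : 0 < L := hℓ.trans_le hℓL
  have hpos : ∀ x, 0 < deriv T x := fun x =>
    (one_div_pos.2 (Real.sqrt_pos.2 hL)).trans_le (hT'bound x).1
  have hκ1 : 1 ≤ κ := by rw [hκ]; exact (one_le_div hℓ).2 hℓL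
  intro x
  have h₃ := deriv_deriv_deriv_eq_of_mongeAmpere hW hW' hT hT' hpos hMA x
  refine ⟨h₃, ?_⟩
  have h₂ := deriv_deriv_eq_of_mongeAmpere hW hT hT' hpos hMA x
  have hTx : |T x - xt| ≤ 1 / √ℓ * (3 + |x|) := by
    have h := abs_sub_le_mul_abs_sub_of_abs_deriv_le hT
      (fun y => (abs_of_pos (hpos y)).trans_le (hT'bound y).2) 0 x
    rw [sub_zero] at h
    calc |T x - xt| ≤ |T x - T 0| + |T 0 - xt| := abs_sub_le _ _ _
      _ ≤ 1 / √ℓ * |x| + 3 / √ℓ := add_le_add h hclose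
      _ = 1 / √ℓ * (3 + |x|) := by ring
  have hWx : |deriv W (T x)| ≤ L * |T x - xt| := by
    have h := abs_sub_le_mul_abs_sub_of_abs_deriv_le hW'
      (fun y => (abs_of_pos (hℓ.trans_le (hW'' y).1)).trans_le (hW'' y).2) xt (T x)
    rwa [hxt, sub_zero] at h
  have hg : |deriv W (T x) * deriv T x| ≤ κ * (3 + |x|) := by
    rw [abs_mul, abs_of_pos (hpos x)]
    calc |deriv W (T x)| * deriv T x
        ≤ (L * (1 / √ℓ * (3 + |x|))) * (1 / √ℓ) :=
          mul_le_mul (hWx.trans (by gcongr)) (hT'bound x).2 (hpos x).le (by positivity)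
      _ = L / (√ℓ * √ℓ) * (3 + |x|) := by field_simp
      _ = κ * (3 + |x|) := by rw [hss, hκ]
  have hq : deriv (deriv W) (T x) * deriv T x ^ 2 ≤ κ := by
    calc deriv (deriv W) (T x) * deriv T x ^ 2 ≤ L * (1 / √ℓ) ^ 2 :=
          mul_le_mul (hW'' _).2 (pow_le_pow_left₀ (hpos x).le (hT'bound x).2 2)
            (by positivity) hL.le
      _ = L / (√ℓ * √ℓ) := by field_simp
      _ = κ := by rw [hss, hκ]
  have hq0 : 0 ≤ deriv (deriv W) (T x) * deriv T x ^ 2 :=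
    mul_nonneg (hℓ.le.trans (hW'' _).1) (sq_nonneg _)
  have hfactor : deriv (deriv (deriv T)) x = deriv T x *
      ((deriv W (T x) * deriv T x - x) * (2 * (deriv W (T x) * deriv T x) - x)
        + (deriv (deriv W) (T x) * deriv T x ^ 2 - 1)) := by
    have hx := (hpos x).ne'
    rw [h₃, h₂]
    field_simp
    ring
  generalize deriv W (T x) * deriv T x = g at hg hfactor
  generalize deriv (deriv W) (T x) * deriv T x ^ 2 = q at hq hq0 hfactor
  have hxκ : |x| ≤ κ * |x| := le_mul_of_one_le_left (abs_nonneg x) hκ1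
  have hA : |g - x| ≤ κ * (3 + 2 * |x|) := by
    linarith [abs_sub g x]
  have hB : |2 * g - x| ≤ κ * (6 + 3 * |x|) := by
    have h := abs_sub (2 * g) x
    rw [abs_mul, abs_two] at h
    linarith
  have hC : |q - 1| ≤ κ ^ 2 :=
    abs_le.2 ⟨by nlinarith, by nlinarith⟩
  have hsum : |(g - x) * (2 * g - x) + (q - 1)| ≤ 40 * κ ^ 2 * (1 + x ^ 2) := by
    calc |(g - x) * (2 * g - x) + (q - 1)|
        ≤ |g - x| * |2 * g - x| + |q - 1| := (abs_add_le _ _).trans_eq (by rw [abs_mul])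
      _ ≤ κ * (3 + 2 * |x|) * (κ * (6 + 3 * |x|)) + κ ^ 2 := by gcongr
      _ = κ ^ 2 * (19 + 21 * |x| + 6 * |x| ^ 2) := by ring
      _ ≤ κ ^ 2 * (40 * (1 + |x| ^ 2)) := by
          gcongr
          nlinarith [sq_nonneg (|x| - 1)]
      _ = 40 * κ ^ 2 * (1 + x ^ 2) := by rw [sq_abs]; ring
  rw [hfactor, abs_mul, abs_of_pos (hpos x)]
  calc deriv T x * |(g - x) * (2 * g - x) + (q - 1)|
      ≤ 1 / √ℓ * (40 * κ ^ 2 * (1 + x ^ 2)) :=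
        mul_le_mul (hT'bound x).2 hsum (abs_nonneg _) (by positivity)
    _ = 40 * κ ^ 2 / √ℓ * (1 + x ^ 2) := by ring
end

section
/- Let β, B > 0 and let f : ℝ → ℝ be twice differentiable with 0 ≤ f'(x) ≤ β and |f''(x)| ≤ B·(1 + |x|) for all x ∈ ℝ. Let γ be the standard Gaussian measure N(0,1) on ℝ, and let ψ : ℝ → ℝ be ψ(u) = min(1, max(u, 0)). Then for every ε > 0 there exist J ∈ ℕ, c ∈ ℝ, a ∈ ℝ, δ > 0, and nonnegative reals λ₁, …, λ_J such that the nondecreasing piecewise affine function g(x) = c + Σ_{j=1}^J λⱼ · ψ((x − a − (j−1)δ)/δ) satisfies both ∫ (f − g)² dγ ≤ ε² and ∫ (f' − g')² dγ ≤ ε², where g' denotes the (almost-everywhere defined) derivative of g. -/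
open MeasureTheory ProbabilityTheory

open Filter Topology

/-- The piecewise affine interpolant of `f` on the grid `a, a + δ, …, a + J δ`, extended by
constants on both sides. -/
noncomputable def rampInterp (f : ℝ → ℝ) (a δ : ℝ) (J : ℕ) (x : ℝ) : ℝ :=
  f a + ∑ j ∈ Finset.range J,
    (f (a + ((j + 1 : ℕ) : ℝ) * δ) - f (a + j * δ)) * min 1 (max ((x - a - j * δ) / δ) 0)

section Interpolation

variable {f : ℝ → ℝ} {a δ x β : ℝ} {J k : ℕ}

lemma rampInterp_succ (f : ℝ → ℝ) (a δ x : ℝ) (J : ℕ) :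
    rampInterp f a δ (J + 1) x = rampInterp f a δ J x +
      (f (a + ((J + 1 : ℕ) : ℝ) * δ) - f (a + J * δ)) *
        min 1 (max ((x - a - J * δ) / δ) 0) := by
  simp only [rampInterp, Finset.sum_range_succ, add_assoc]

lemma continuous_rampInterp (f : ℝ → ℝ) (a δ : ℝ) (J : ℕ) :
    Continuous (rampInterp f a δ J) := by
  unfold rampInterp
  fun_prop

lemma rampInterp_of_ge (hδ : 0 < δ) (hx : a + J * δ ≤ x) :
    rampInterp f a δ J x = f (a + J * δ) := by
  induction J with
  | zero => simp [rampInterp]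
  | succ J ih =>
    push_cast at hx
    have h1 : 1 ≤ (x - a - J * δ) / δ := by
      rw [le_div_iff₀ hδ]; linarith
    rw [rampInterp_succ, ih (by linarith), min_eq_left (h1.trans (le_max_left _ _))]
    ring

lemma rampInterp_of_le (hδ : 0 < δ) (hk : k ≤ J) (hx : x ≤ a + k * δ) :
    rampInterp f a δ J x = rampInterp f a δ k x := by
  induction J, hk using Nat.le_induction with
  | base => rfl
  | succ J hJ ih =>
    have hJ' : (k : ℝ) * δ ≤ J * δ := by gcongr
    have h1 : (x - a - J * δ) / δ ≤ 0 := div_nonpos_of_nonpos_of_nonneg (by linarith) hδ.le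
    rw [rampInterp_succ, ih, max_eq_right h1]
    simp

lemma rampInterp_of_le_left (hδ : 0 < δ) (hx : x ≤ a) : rampInterp f a δ J x = f a := by
  rw [rampInterp_of_le hδ (Nat.zero_le J) (by simpa using hx)]
  simp [rampInterp]

lemma rampInterp_of_mem_cell (hδ : 0 < δ) (hk : k < J)
    (hx : x ∈ Set.Icc (a + k * δ) (a + k * δ + δ)) :
    rampInterp f a δ J x = f (a + k * δ) +
      (f (a + k * δ + δ) - f (a + k * δ)) / δ * (x - (a + k * δ)) := by
  obtain ⟨h1, h2⟩ := hx
  have e : a + ((k + 1 : ℕ) : ℝ) * δ = a + k * δ + δ := by push_cast; ring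
  rw [rampInterp_of_le hδ hk (e ▸ h2), rampInterp_succ, rampInterp_of_ge hδ h1, e,
    max_eq_left (div_nonneg (by linarith) hδ.le), min_eq_right]
  · field_simp
    ring
  · rw [div_le_one hδ]; linarith

lemma exists_mem_cell (hδ : 0 < δ) (hx : x ∈ Set.Ico a (a + J * δ)) :
    ∃ k < J, x ∈ Set.Ico (a + k * δ) (a + k * δ + δ) := by
  obtain ⟨h1, h2⟩ := hx
  have h0 : 0 ≤ (x - a) / δ := div_nonneg (by linarith) hδ.le
  refine ⟨⌊(x - a) / δ⌋₊, ?_, ?_, ?_⟩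
  · rw [Nat.floor_lt h0, div_lt_iff₀ hδ]; linarith
  · have := Nat.floor_le h0
    rw [le_div_iff₀ hδ] at this; linarith
  · have := Nat.lt_floor_add_one ((x - a) / δ)
    rw [div_lt_iff₀ hδ] at this; linarith

lemma abs_sub_rampInterp_le (hδ : 0 < δ) (hmono : Monotone f)
    (hlip : ∀ x y, |f x - f y| ≤ β * |x - y|) (hx : x ∈ Set.Ico a (a + J * δ)) :
    |f x - rampInterp f a δ J x| ≤ β * δ := by
  obtain ⟨k, hk, h1, h2⟩ := exists_mem_cell hδ hx
  rw [rampInterp_of_mem_cell hδ hk ⟨h1, h2.le⟩]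
  set p := a + k * δ
  have hl := hlip (p + δ) p
  rw [add_sub_cancel_left, abs_of_pos hδ] at hl
  have hl' := (abs_le.1 hl).2
  have m1 := hmono h1
  have m2 := hmono h2.le
  have t0 : 0 ≤ (f (p + δ) - f p) / δ * (x - p) :=
    mul_nonneg (div_nonneg (by linarith) hδ.le) (by linarith)
  have t1 : (f (p + δ) - f p) / δ * (x - p) ≤ f (p + δ) - f p := by
    rw [div_mul_eq_mul_div, div_le_iff₀ hδ]
    exact mul_le_mul_of_nonneg_left (by linarith) (by linarith)
  rw [abs_le]
  constructor <;> linarith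

lemma exists_deriv_rampInterp_eq (hδ : 0 < δ) (hf : Differentiable ℝ f)
    (hx : x ∈ Set.Ico a (a + J * δ)) (hgrid : ∀ k : ℕ, x ≠ a + k * δ) :
    ∃ ξ, |ξ - x| ≤ δ ∧ deriv (rampInterp f a δ J) x = deriv f ξ := by
  obtain ⟨k, hk, h1, h2⟩ := exists_mem_cell hδ hx
  have h1' := lt_of_le_of_ne h1 (hgrid k).symm
  have hev : rampInterp f a δ J =ᶠ[𝓝 x] fun y => f (a + k * δ) +
      (f (a + k * δ + δ) - f (a + k * δ)) / δ * (y - (a + k * δ)) := by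
    filter_upwards [Icc_mem_nhds h1' h2] with y hy
    exact rampInterp_of_mem_cell hδ hk hy
  obtain ⟨ξ, ⟨hξ1, hξ2⟩, hξ⟩ := exists_deriv_eq_slope f (lt_add_of_pos_right (a + k * δ) hδ)
    hf.continuous.continuousOn hf.differentiableOn
  refine ⟨ξ, abs_le.2 ⟨by linarith, by linarith⟩, ?_⟩
  rw [hev.deriv_eq, hξ, add_sub_cancel_left]
  simp

lemma deriv_rampInterp_of_lt (hδ : 0 < δ) (hx : x < a) : deriv (rampInterp f a δ J) x = 0 := by
  have : rampInterp f a δ J =ᶠ[𝓝 x] fun _ => f a := by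
    filter_upwards [Iio_mem_nhds hx] with y hy
    exact rampInterp_of_le_left hδ (Set.mem_Iio.1 hy).le
  simp [this.deriv_eq]

lemma deriv_rampInterp_of_gt (hδ : 0 < δ) (hx : a + J * δ < x) :
    deriv (rampInterp f a δ J) x = 0 := by
  have : rampInterp f a δ J =ᶠ[𝓝 x] fun _ => f (a + J * δ) := by
    filter_upwards [Ioi_mem_nhds hx] with y hy
    exact rampInterp_of_ge hδ (Set.mem_Ioi.1 hy).le
  simp [this.deriv_eq]

end Interpolation

/-- The interpolant of `f` on the grid of mesh `1 / (n + 1)` of the interval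
`[-(n + 1), n + 1]`. -/
noncomputable def gridInterp (f : ℝ → ℝ) (n : ℕ) : ℝ → ℝ :=
  rampInterp f (-(n + 1)) (1 / (n + 1)) (2 * (n + 1) ^ 2)

section Grid

variable {f : ℝ → ℝ} {x β : ℝ} {n : ℕ}

lemma grid_right_end (n : ℕ) :
    (-(n + 1) + ((2 * (n + 1) ^ 2 : ℕ) : ℝ) * (1 / (n + 1)) : ℝ) = n + 1 := by
  have : (n + 1 : ℝ) ≠ 0 := by positivity
  push_cast
  field_simp
  ring

lemma abs_sub_gridInterp_le (hmono : Monotone f)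
    (hlip : ∀ x y, |f x - f y| ≤ β * |x - y|) (hx : |x| < n + 1) :
    |f x - gridInterp f n x| ≤ β * (1 / (n + 1)) := by
  obtain ⟨h1, h2⟩ := abs_lt.1 hx
  exact abs_sub_rampInterp_le (by positivity) hmono hlip
    ⟨h1.le, by rwa [grid_right_end]⟩

lemma abs_sub_gridInterp_le_affine (hβ : 0 ≤ β) (hmono : Monotone f)
    (hlip : ∀ x y, |f x - f y| ≤ β * |x - y|) (n : ℕ) (x : ℝ) :
    |f x - gridInterp f n x| ≤ β * (1 + |x|) := by
  have hn : (0 : ℝ) < n + 1 := by positivity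
  have hδ : (0 : ℝ) < 1 / (n + 1) := by positivity
  rcases lt_or_ge |x| (n + 1) with hx | hx
  · refine (abs_sub_gridInterp_le hmono hlip hx).trans (mul_le_mul_of_nonneg_left ?_ hβ)
    have : (1 : ℝ) / (n + 1) ≤ 1 := by
      rw [div_le_one hn]; linarith [n.cast_nonneg (α := ℝ)]
    linarith [abs_nonneg x]
  · rcases le_abs.1 hx with h | h
    · rw [gridInterp, rampInterp_of_ge hδ (by rwa [grid_right_end]), grid_right_end]
      refine (hlip _ _).trans (mul_le_mul_of_nonneg_left ?_ hβ)
      rw [abs_of_nonneg (by linarith)]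
      linarith [le_abs_self x]
    · rw [gridInterp, rampInterp_of_le_left hδ (by linarith)]
      refine (hlip _ _).trans (mul_le_mul_of_nonneg_left ?_ hβ)
      rw [abs_of_nonpos (by linarith)]
      linarith [neg_le_abs x]

lemma exists_deriv_gridInterp_eq (hf : Differentiable ℝ f) (hirr : Irrational x)
    (hx : |x| < n + 1) :
    ∃ ξ, |ξ - x| ≤ 1 / (n + 1) ∧ deriv (gridInterp f n) x = deriv f ξ := by
  obtain ⟨h1, h2⟩ := abs_lt.1 hx
  refine exists_deriv_rampInterp_eq (by positivity) hf
    ⟨h1.le, by rwa [grid_right_end]⟩ fun k hk => hirr ?_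
  exact ⟨-(n + 1) + k * (1 / (n + 1)), by rw [hk]; push_cast; rfl⟩

lemma deriv_gridInterp_mem_Icc (hf : Differentiable ℝ f) (hβ : 0 ≤ β)
    (hd : ∀ x, 0 ≤ deriv f x ∧ deriv f x ≤ β) (hirr : Irrational x) (n : ℕ) :
    deriv (gridInterp f n) x ∈ Set.Icc 0 β := by
  have hδ : (0 : ℝ) < 1 / (n + 1) := by positivity
  rcases lt_or_ge |x| (n + 1) with hx | hx
  · obtain ⟨ξ, -, h⟩ := exists_deriv_gridInterp_eq hf hirr hx
    rw [h]
    exact hd ξ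
  · suffices deriv (gridInterp f n) x = 0 by simp [this, hβ]
    have hne : |x| ≠ n + 1 := fun h => by
      rcases eq_or_eq_neg_of_abs_eq h with h | h
      · exact hirr ⟨n + 1, by rw [h]; push_cast; rfl⟩
      · exact hirr ⟨-(n + 1), by rw [h]; push_cast; rfl⟩
    rcases lt_abs.1 (lt_of_le_of_ne hx hne.symm) with h | h
    · exact deriv_rampInterp_of_gt hδ (by rwa [grid_right_end])
    · exact deriv_rampInterp_of_lt hδ (by linarith)

lemma tendsto_gridInterp (hmono : Monotone f)
    (hlip : ∀ x y, |f x - f y| ≤ β * |x - y|) (x : ℝ) :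
    Tendsto (fun n => f x - gridInterp f n x) atTop (𝓝 0) := by
  have h0 : Tendsto (fun n : ℕ => β * (1 / ((n : ℝ) + 1))) atTop (𝓝 0) := by
    simpa using tendsto_one_div_add_atTop_nhds_zero_nat.const_mul β
  refine squeeze_zero_norm' ?_ h0
  filter_upwards [tendsto_natCast_atTop_atTop.eventually_ge_atTop |x|] with n hn
  exact abs_sub_gridInterp_le hmono hlip (by linarith)

lemma tendsto_deriv_gridInterp (hf : Differentiable ℝ f) (hf' : Continuous (deriv f))
    (hirr : Irrational x) :
    Tendsto (fun n => deriv f x - deriv (gridInterp f n) x) atTop (𝓝 0) := by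
  have hev : ∀ᶠ n : ℕ in atTop, ∃ ξ, |ξ - x| ≤ 1 / ((n : ℝ) + 1) ∧
      deriv (gridInterp f n) x = deriv f ξ := by
    filter_upwards [tendsto_natCast_atTop_atTop.eventually_ge_atTop |x|] with n hn
    exact exists_deriv_gridInterp_eq hf hirr (by linarith)
  rw [Metric.tendsto_nhds]
  intro e he
  obtain ⟨d, hd, hcont⟩ := Metric.continuous_iff.1 hf' x e he
  filter_upwards [hev,
    tendsto_one_div_add_atTop_nhds_zero_nat.eventually_lt_const hd] with n ⟨ξ, hξ, h⟩ hn
  have := hcont ξ (by rw [Real.dist_eq]; linarith)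
  rwa [h, dist_zero_right, ← dist_eq_norm, dist_comm]

end Grid

lemma ae_irrational_gaussianReal : ∀ᵐ x ∂(gaussianReal 0 1), Irrational x := by
  have := nullSingletonClass_gaussianReal (μ := 0) (v := 1) one_ne_zero
  exact (Set.countable_range ((↑) : ℚ → ℝ)).ae_notMem _

lemma tendsto_integral_sq_of_abs_le {Ω : Type*} [MeasurableSpace Ω] {μ : Measure Ω}
    {F : ℕ → Ω → ℝ} {b : Ω → ℝ} (hF : ∀ n, AEStronglyMeasurable (F n) μ) (hb : MemLp b 2 μ)
    (hle : ∀ n, ∀ᵐ x ∂μ, |F n x| ≤ b x)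
    (hlim : ∀ᵐ x ∂μ, Tendsto (fun n => F n x) atTop (𝓝 0)) :
    Tendsto (fun n => ∫ x, F n x ^ 2 ∂μ) atTop (𝓝 0) := by
  have h := tendsto_integral_of_dominated_convergence (μ := μ) (F := fun n x => F n x ^ 2)
    (f := fun _ => 0) (fun x => b x ^ 2) (fun n => (hF n).pow 2) hb.integrable_sq
    (fun n => ?_) ?_
  · simpa using h
  · filter_upwards [hle n] with x hx
    rw [Real.norm_eq_abs, abs_pow]
    gcongr
  · filter_upwards [hlim] with x hx
    simpa using hx.pow 2

theorem stmt_16 (β B : ℝ) (hβ : 0 < β) (hB : 0 < B)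
    (f : ℝ → ℝ) (hf : Differentiable ℝ f) (hf' : Differentiable ℝ (deriv f))
    (hd1 : ∀ x, 0 ≤ deriv f x ∧ deriv f x ≤ β)
    (hd2 : ∀ x, |deriv (deriv f) x| ≤ B * (1 + |x|))
    (ψ : ℝ → ℝ) (hψ : ψ = fun u => min 1 (max u 0)) :
    ∀ ε > (0 : ℝ), ∃ (J : ℕ) (c a δ : ℝ) (lam : Fin J → ℝ),
      0 < δ ∧ (∀ j, 0 ≤ lam j) ∧
      ∃ g : ℝ → ℝ,
        (g = fun x => c + ∑ j : Fin J, lam j * ψ ((x - a - (j : ℕ) * δ) / δ)) ∧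
        (∫ x, (f x - g x) ^ 2 ∂(gaussianReal 0 1) ≤ ε ^ 2) ∧
        (∫ x, (deriv f x - deriv g x) ^ 2 ∂(gaussianReal 0 1) ≤ ε ^ 2) := by
  intro ε hε
  have hmono : Monotone f := monotone_of_deriv_nonneg hf fun x => (hd1 x).1
  have hlip : ∀ x y, |f x - f y| ≤ β * |x - y| := fun x y =>
    convex_univ.norm_image_sub_le_of_norm_deriv_le (fun z _ => hf z)
      (fun z _ => by rw [Real.norm_eq_abs, abs_of_nonneg (hd1 z).1]; exact (hd1 z).2)
      (Set.mem_univ y) (Set.mem_univ x)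
  have hval : Tendsto (fun n => ∫ x, (f x - gridInterp f n x) ^ 2 ∂(gaussianReal 0 1))
      atTop (𝓝 0) := by
    refine tendsto_integral_sq_of_abs_le (b := fun x => β * (1 + |x|)) (fun n => ?_) ?_
      (fun n => .of_forall (abs_sub_gridInterp_le_affine hβ.le hmono hlip n))
      (.of_forall (tendsto_gridInterp hmono hlip))
    · exact (hf.continuous.sub (continuous_rampInterp _ _ _ _)).aestronglyMeasurable
    · have habs : MemLp (fun x : ℝ => |x|) 2 (gaussianReal 0 1) :=
        (memLp_id_gaussianReal' 2 ENNReal.ofNat_ne_top).norm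
      exact ((memLp_const (1 : ℝ)).add habs).const_mul β
  have hder : Tendsto
      (fun n => ∫ x, (deriv f x - deriv (gridInterp f n) x) ^ 2 ∂(gaussianReal 0 1))
      atTop (𝓝 0) := by
    refine tendsto_integral_sq_of_abs_le (b := fun _ => β) (fun n => ?_) (memLp_const β)
      (fun n => ?_) ?_
    · exact ((measurable_deriv f).sub (measurable_deriv _)).aestronglyMeasurable
    · filter_upwards [ae_irrational_gaussianReal] with x hx
      obtain ⟨h1, h2⟩ := deriv_gridInterp_mem_Icc hf hβ.le hd1 hx n
      obtain ⟨h3, h4⟩ := hd1 x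
      exact abs_le.2 ⟨by linarith, by linarith⟩
    · filter_upwards [ae_irrational_gaussianReal] with x hx
      exact tendsto_deriv_gridInterp hf hf'.continuous hx
  have hε2 : 0 < ε ^ 2 := by positivity
  obtain ⟨n, h1, h2⟩ :=
    ((hval.eventually_le_const hε2).and (hder.eventually_le_const hε2)).exists
  have hδ : (0 : ℝ) < 1 / (n + 1) := by positivity
  refine ⟨2 * (n + 1) ^ 2, f (-(n + 1)), -(n + 1), 1 / (n + 1),
    fun j => f (-(n + 1) + ((j + 1 : ℕ) : ℝ) * (1 / (n + 1))) -
      f (-(n + 1) + (j : ℕ) * (1 / (n + 1))), hδ, fun j => ?_, gridInterp f n, ?_, h1, h2⟩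
  · refine sub_nonneg.2 (hmono ?_)
    gcongr
    simp
  · funext x
    rw [gridInterp, rampInterp, ← Fin.sum_univ_eq_sum_range (fun j : ℕ =>
      (f (-(n + 1) + ((j + 1 : ℕ) : ℝ) * (1 / (n + 1))) - f (-(n + 1) + j * (1 / (n + 1)))) *
        min 1 (max ((x - -(n + 1) - j * (1 / (n + 1))) / (1 / (n + 1))) 0)), hψ]
end

section
/- Let a ∈ ℝ, δ > 0, and K ≥ 1. Let ν be a probability measure on ℝ supported in the interval [a, a + δ], absolutely continuous with density p, and suppose that p(x) ≤ K·p(y) for (Lebesgue-)almost every x, y ∈ [a, a + δ]. Then the variance of ν satisfies Var(ν) = ∫ (x − μ)² dν(x) ≥ δ²/(64K), where μ = ∫ x dν(x). -/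
open MeasureTheory

/-- A measure with total mass one on a set of volume `δ`, whose density oscillates by a factor
at most `K` there, dominates the constant density `1 / (2 * K * δ)` on that set. The density need
not be measurable. -/
lemma smul_restrict_le_withDensity_of_ae_le_mul {α : Type*} [MeasurableSpace α] {m : Measure α}
    {I : Set α} {δ K : ℝ} (hI : MeasurableSet I) (hδ : 0 < δ) (hK : 0 < K)
    (hvol : m I = ENNReal.ofReal δ) {p : α → ℝ}
    (hmass : (m.withDensity fun x => ENNReal.ofReal (p x)) I = 1)
    (hosc : ∀ᵐ x ∂m.restrict I, ∀ᵐ y ∂m.restrict I, p x ≤ K * p y) :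
    ENNReal.ofReal (1 / (2 * K * δ)) • m.restrict I ≤
      m.withDensity fun x => ENNReal.ofReal (p x) := by
  obtain ⟨x, hx, hxp⟩ : ∃ x, (∀ᵐ y ∂m.restrict I, p x ≤ K * p y) ∧ 1 / (2 * δ) < p x := by
    by_contra! hsmall
    have hle : ∫⁻ x in I, ENNReal.ofReal (p x) ∂m ≤
        ∫⁻ _ in I, ENNReal.ofReal (1 / (2 * δ)) ∂m :=
      lintegral_mono_ae (hosc.mono fun x hx => ENNReal.ofReal_le_ofReal (hsmall x hx))
    rw [← withDensity_apply _ hI, hmass, setLIntegral_const, hvol,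
      ← ENNReal.ofReal_mul (by positivity), ENNReal.one_le_ofReal] at hle
    have : 1 / (2 * δ) * δ = 1 / 2 := by field_simp
    linarith
  have hlow : ∀ᵐ y ∂m.restrict I, ENNReal.ofReal (1 / (2 * K * δ)) ≤ ENNReal.ofReal (p y) := by
    filter_upwards [hx] with y hy
    refine ENNReal.ofReal_le_ofReal ?_
    have : 1 / (2 * K * δ) = 1 / (2 * δ) / K := by field_simp
    rw [this, div_le_iff₀ hK]
    linarith
  refine Measure.le_iff.2 fun s hs => ?_
  calc (ENNReal.ofReal (1 / (2 * K * δ)) • m.restrict I) s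
      = ∫⁻ _ in s, ENNReal.ofReal (1 / (2 * K * δ)) ∂m.restrict I := by
        simp
    _ ≤ ∫⁻ y in s, ENNReal.ofReal (p y) ∂m.restrict I :=
        lintegral_mono_ae (ae_restrict_of_ae hlow)
    _ ≤ ∫⁻ y in s, ENNReal.ofReal (p y) ∂m :=
        lintegral_mono' (Measure.restrict_mono_measure Measure.restrict_le_self s) le_rfl
    _ = (m.withDensity fun x => ENNReal.ofReal (p x)) s := (withDensity_apply _ hs).symm

lemma cube_div_twelve_le_setIntegral_sub_sq {δ : ℝ} (hδ : 0 ≤ δ) (a c : ℝ) :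
    δ ^ 3 / 12 ≤ ∫ x in Set.Icc a (a + δ), (x - c) ^ 2 := by
  rw [integral_Icc_eq_integral_Ioc, ← intervalIntegral.integral_of_le (by linarith),
    intervalIntegral.integral_comp_sub_right (fun x => x ^ 2), integral_pow]
  push_cast
  nlinarith [mul_nonneg hδ (sq_nonneg (a - c + δ / 2))]

theorem stmt_17 (a δ : ℝ) (hδ : 0 < δ) (K : ℝ) (hK : 1 ≤ K)
    (ν : Measure ℝ) [IsProbabilityMeasure ν]
    (hsupp : ν (Set.Icc a (a + δ))ᶜ = 0)
    (p : ℝ → ℝ)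
    (hac : ν = volume.withDensity fun x => ENNReal.ofReal (p x))
    (hosc : ∀ᵐ x ∂volume.restrict (Set.Icc a (a + δ)),
      ∀ᵐ y ∂volume.restrict (Set.Icc a (a + δ)), p x ≤ K * p y)
    (μ : ℝ) (hμ : μ = ∫ x, x ∂ν) :
    δ ^ 2 / (64 * K) ≤ ∫ x, (x - μ) ^ 2 ∂ν := by
  have hK0 : 0 < K := by linarith
  have hmass : ν (Set.Icc a (a + δ)) = 1 :=
    (prob_compl_eq_zero_iff measurableSet_Icc).1 hsupp
  have hle : ENNReal.ofReal (1 / (2 * K * δ)) • volume.restrict (Set.Icc a (a + δ)) ≤ ν := by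
    rw [hac] at hmass ⊢
    exact smul_restrict_le_withDensity_of_ae_le_mul measurableSet_Icc hδ hK0 (by simp) hmass hosc
  have hint : Integrable (fun x => (x - μ) ^ 2) ν := by
    have hres : ν.restrict (Set.Icc a (a + δ)) = ν :=
      Measure.restrict_eq_self_of_ae_mem (mem_ae_iff.2 hsupp)
    rw [← hres]
    exact ContinuousOn.integrableOn_compact isCompact_Icc (by fun_prop)
  calc δ ^ 2 / (64 * K) ≤ δ ^ 2 / (24 * K) := by gcongr; norm_num
    _ = 1 / (2 * K * δ) * (δ ^ 3 / 12) := by field_simp; norm_num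
    _ ≤ 1 / (2 * K * δ) * ∫ x in Set.Icc a (a + δ), (x - μ) ^ 2 := by
        gcongr
        exact cube_div_twelve_le_setIntegral_sub_sq hδ.le a μ
    _ = ∫ x, (x - μ) ^ 2 ∂(ENNReal.ofReal (1 / (2 * K * δ)) •
          volume.restrict (Set.Icc a (a + δ))) := by
        rw [integral_smul_measure, ENNReal.toReal_ofReal (by positivity), smul_eq_mul]
    _ ≤ ∫ x, (x - μ) ^ 2 ∂ν :=
        integral_mono_measure hle (ae_of_all _ fun x => sq_nonneg _) hint
end
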